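/- Suppose d is a differential on A with d(x1) = x2*x3 + x3*x2, d(x2) = 0, and d(x3) = 0. Then for every n ≥ 0: ker d ∩ A_n = (range d ∩ A_n) + span_k{ x2^i * x3^j : i + j = n }, and span_k{ x2^i * x3^j : i + j = n } ∩ range d = 0. (Equivalently, the cohomology algebra H(A, d) is isomorphic to k⟨⌈x2⌉, ⌈x3⌉⟩/(⌈x2⌉·⌈x3⌉ + ⌈x3⌉·⌈x2⌉).) -/

import Mathlib

noncomputable section

/-- `V`, the `k`-linear span of the generators `x1, x2, x3` in the free algebra
`A = k⟨x1,x2,x3⟩`; the `m`-th graded piece of `A` is `A_m = V^m`. -/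
def Vgen (k : Type*) [Field k] : Submodule k (FreeAlgebra k (Fin 3)) :=
  Submodule.span k {FreeAlgebra.ι k 0, FreeAlgebra.ι k 1, FreeAlgebra.ι k 2}

/-- A differential on `A = k⟨x1,x2,x3⟩` (making `A` a connected cochain DG algebra with
generators in degree `1`): a `k`-linear map `d : A → A` with `d(A_m) ⊆ A_{m+1}`, the graded
Leibniz rule, and `d ∘ d = 0`. -/
def IsDGDifferential (k : Type*) [Field k]
    (d : FreeAlgebra k (Fin 3) →ₗ[k] FreeAlgebra k (Fin 3)) : Prop :=
  (∀ m : ℕ, ∀ a ∈ (Vgen k) ^ m, d a ∈ (Vgen k) ^ (m + 1)) ∧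
  (∀ m : ℕ, ∀ a ∈ (Vgen k) ^ m, ∀ b : FreeAlgebra k (Fin 3),
    d (a * b) = d a * b + ((-1 : k) ^ m) • (a * d b)) ∧
  (∀ a : FreeAlgebra k (Fin 3), d (d a) = 0)

open FreeAlgebra

section

variable {k : Type*} [Field k]

/-- The span of the normal monomials `x2^i * x3^j` of degree `n`. -/
def normalSpan (k : Type*) [Field k] (n : ℕ) : Submodule k (FreeAlgebra k (Fin 3)) :=
  Submodule.span k
    {p : FreeAlgebra k (Fin 3) | ∃ i j : ℕ, i + j = n ∧ p = ι k 1 ^ i * ι k 2 ^ j}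

/-- The graded piece of degree `n - 1`, which is zero for `n = 0`. -/
def prevPiece (k : Type*) [Field k] : ℕ → Submodule k (FreeAlgebra k (Fin 3))
  | 0 => ⊥
  | n + 1 => Vgen k ^ n

/-- A submodule of a free algebra containing `1` and stable under left multiplication by the
generators is everything. -/
theorem FreeAlgebra.mem_of_one_mem_of_ι_mul_mem {X : Type*}
    (S : Submodule k (FreeAlgebra k X)) (h1 : 1 ∈ S)
    (hmul : ∀ i, ∀ a ∈ S, ι k i * a ∈ S) (a : FreeAlgebra k X) : a ∈ S := by
  suffices h : ∀ s ∈ S, a * s ∈ S by simpa using h 1 h1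
  induction a using FreeAlgebra.induction with
  | grade0 r => intro s hs; simpa [← Algebra.smul_def] using S.smul_mem r hs
  | grade1 i => exact hmul i
  | mul a b ha hb => intro s hs; rw [mul_assoc]; exact ha _ (hb s hs)
  | add a b ha hb => intro s hs; rw [add_mul]; exact S.add_mem (ha s hs) (hb s hs)

/-- The action of the free algebra on `A × (X → A)` in which the generator `i` sends `(a, f)` to
`(i * a, Pi.single i a)`. -/
def leftDivAction (k : Type*) [Field k] (X : Type*) [DecidableEq X] :
    FreeAlgebra k X →ₐ[k]
      Module.End k (FreeAlgebra k X × (X → FreeAlgebra k X)) :=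
  FreeAlgebra.lift k fun i =>
    ((LinearMap.mulLeft k (ι k i)).prod (LinearMap.single k (fun _ => FreeAlgebra k X) i)) ∘ₗ
      LinearMap.fst k _ _

theorem leftDivAction_fst {X : Type*} [DecidableEq X] (a : FreeAlgebra k X)
    (m : FreeAlgebra k X × (X → FreeAlgebra k X)) :
    (leftDivAction k X a m).1 = a * m.1 := by
  induction a using FreeAlgebra.induction generalizing m with
  | grade0 r => simp [← Algebra.smul_def, Module.algebraMap_end_apply]
  | grade1 i => simp [leftDivAction]
  | mul a b ha hb => simp [ha, hb, mul_assoc]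
  | add a b ha hb => simp [ha, hb, add_mul]

/-- The coefficients of `a` in the decomposition of the free algebra as scalars plus the sum of
the right ideals generated by the generators. -/
def leftDiv (k : Type*) [Field k] (X : Type*) [DecidableEq X] :
    FreeAlgebra k X →ₗ[k] (X → FreeAlgebra k X) :=
  LinearMap.snd k _ _ ∘ₗ LinearMap.applyₗ (1, 0) ∘ₗ (leftDivAction k X).toLinearMap

theorem leftDiv_ι_mul {X : Type*} [DecidableEq X] (i : X) (a : FreeAlgebra k X) :
    leftDiv k X (ι k i * a) = Pi.single i a := by
  have h := leftDivAction_fst a (1, 0)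
  simp only [mul_one] at h
  simp only [leftDiv, LinearMap.comp_apply, AlgHom.toLinearMap_apply, map_mul,
    LinearMap.applyₗ_apply_apply, Module.End.mul_apply]
  conv_lhs => rw [leftDivAction, lift_ι_apply, ← leftDivAction]
  simp [h]

theorem eq_zero_of_ι_mul_add_eq_zero {p q r : FreeAlgebra k (Fin 3)}
    (h : ι k 0 * r + ι k 1 * p + ι k 2 * q = 0) : r = 0 ∧ p = 0 ∧ q = 0 := by
  have h' := congrArg (leftDiv k (Fin 3)) h
  simp only [map_add, leftDiv_ι_mul, map_zero] at h'
  exact ⟨by simpa using congrFun h' 0, by simpa using congrFun h' 1,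
    by simpa using congrFun h' 2⟩

/-- The action of `x2` on the skew polynomial algebra with basis the normal monomials. -/
def skewY (k : Type*) [Field k] : Module.End k (ℕ × ℕ →₀ k) :=
  Finsupp.linearCombination k fun p => Finsupp.single (p.1 + 1, p.2) 1

/-- The action of `x3` on the skew polynomial algebra with basis the normal monomials. -/
def skewZ (k : Type*) [Field k] : Module.End k (ℕ × ℕ →₀ k) :=
  Finsupp.linearCombination k fun p => Finsupp.single (p.1, p.2 + 1) ((-1) ^ p.1)

theorem skewY_mul_skewZ_add : skewY k * skewZ k + skewZ k * skewY k = 0 := by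
  ext p : 2
  obtain ⟨i, j⟩ := p
  simp [skewY, skewZ, pow_succ, Finsupp.single_neg]

/-- The representation of the free algebra on the skew polynomial algebra, with `x1` acting
as zero. -/
def skewRep (k : Type*) [Field k] : FreeAlgebra k (Fin 3) →ₐ[k] Module.End k (ℕ × ℕ →₀ k) :=
  FreeAlgebra.lift k ![0, skewY k, skewZ k]

theorem skewRep_normal (i j : ℕ) :
    skewRep k (ι k 1 ^ i * ι k 2 ^ j) (Finsupp.single (0, 0) 1) = Finsupp.single (i, j) 1 := by
  have hz : (skewZ k ^ j) (Finsupp.single (0, 0) 1) = Finsupp.single (0, j) 1 := by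
    induction j with
    | zero => simp
    | succ j ih => rw [pow_succ', Module.End.mul_apply, ih]; simp [skewZ]
  have hy : (skewY k ^ i) (Finsupp.single (0, j) 1) = Finsupp.single (i, j) 1 := by
    induction i with
    | zero => simp
    | succ i ih => rw [pow_succ', Module.End.mul_apply, ih]; simp [skewY]
  simp [skewRep, hz, hy]

theorem eq_zero_of_mem_normalSpan {n : ℕ} {p : FreeAlgebra k (Fin 3)} (hp : p ∈ normalSpan k n)
    (h : skewRep k p = 0) : p = 0 := by
  let σ : (ℕ × ℕ →₀ k) →ₗ[k] FreeAlgebra k (Fin 3) :=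
    Finsupp.linearCombination k fun q => ι k 1 ^ q.1 * ι k 2 ^ q.2
  have key : Set.EqOn
      (σ ∘ₗ LinearMap.applyₗ (Finsupp.single (0, 0) 1) ∘ₗ (skewRep k).toLinearMap)
      (LinearMap.id : FreeAlgebra k (Fin 3) →ₗ[k] FreeAlgebra k (Fin 3)) (normalSpan k n) := by
    refine LinearMap.eqOn_span ?_
    rintro _ ⟨i, j, -, rfl⟩
    simp only [LinearMap.comp_apply, AlgHom.toLinearMap_apply, LinearMap.applyₗ_apply_apply,
      skewRep_normal]
    simp [σ]
  have := key hp
  simpa [h] using this.symm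

theorem ι_mem_Vgen (i : Fin 3) : ι k i ∈ Vgen k := by
  apply Submodule.subset_span
  fin_cases i <;> simp

theorem ι_mul_mem_Vgen_pow {n : ℕ} (i : Fin 3) {a : FreeAlgebra k (Fin 3)}
    (ha : a ∈ Vgen k ^ n) : ι k i * a ∈ Vgen k ^ (n + 1) := by
  rw [pow_succ']
  exact Submodule.mul_mem_mul (ι_mem_Vgen i) ha

theorem ι_mul_mem_of_mem_prevPiece {n : ℕ} (i : Fin 3) {a : FreeAlgebra k (Fin 3)}
    (ha : a ∈ prevPiece k n) : ι k i * a ∈ Vgen k ^ n := by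
  cases n with
  | zero => rw [prevPiece, Submodule.mem_bot] at ha; simp [ha]
  | succ n => exact ι_mul_mem_Vgen_pow i ha

theorem exists_of_mem_Vgen_pow_succ {n : ℕ} {a : FreeAlgebra k (Fin 3)}
    (ha : a ∈ Vgen k ^ (n + 1)) :
    ∃ r ∈ Vgen k ^ n, ∃ p ∈ Vgen k ^ n, ∃ q ∈ Vgen k ^ n,
      a = ι k 0 * r + ι k 1 * p + ι k 2 * q := by
  rw [pow_succ'] at ha
  induction ha using Submodule.mul_induction_on' with
  | mem_mul_mem v hv b hb =>
    obtain ⟨s, t, u, rfl⟩ := Submodule.mem_span_triple.mp hv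
    exact ⟨s • b, Submodule.smul_mem _ _ hb, t • b, Submodule.smul_mem _ _ hb,
      u • b, Submodule.smul_mem _ _ hb, by simp [add_mul]⟩
  | add a _ b _ ha hb =>
    obtain ⟨r, hr, p, hp, q, hq, rfl⟩ := ha
    obtain ⟨r', hr', p', hp', q', hq', rfl⟩ := hb
    exact ⟨_, add_mem hr hr', _, add_mem hp hp', _, add_mem hq hq', by noncomm_ring⟩

theorem normalSpan_le_Vgen_pow (n : ℕ) : normalSpan k n ≤ Vgen k ^ n := by
  refine Submodule.span_le.mpr ?_
  rintro _ ⟨i, j, rfl, rfl⟩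
  rw [SetLike.mem_coe, pow_add]
  exact Submodule.mul_mem_mul (Submodule.pow_mem_pow _ (ι_mem_Vgen 1) i)
    (Submodule.pow_mem_pow _ (ι_mem_Vgen 2) j)

theorem ι_one_mul_mem_normalSpan {n : ℕ} {b : FreeAlgebra k (Fin 3)} (hb : b ∈ normalSpan k n) :
    ι k 1 * b ∈ normalSpan k (n + 1) := by
  suffices normalSpan k n ≤ (normalSpan k (n + 1)).comap (LinearMap.mulLeft k (ι k 1)) from this hb
  refine Submodule.span_le.mpr ?_
  rintro _ ⟨i, j, rfl, rfl⟩
  exact Submodule.subset_span ⟨i + 1, j, by omega, by simp [pow_succ', mul_assoc]⟩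

namespace IsDGDifferential

variable {d : FreeAlgebra k (Fin 3) →ₗ[k] FreeAlgebra k (Fin 3)}

theorem map_one (hd : IsDGDifferential k d) : d 1 = 0 := by
  simpa using hd.2.1 0 1 (by simp) 1

theorem map_ι_mul (hd : IsDGDifferential k d) (i : Fin 3) (a : FreeAlgebra k (Fin 3)) :
    d (ι k i * a) = d (ι k i) * a - ι k i * d a := by
  have h := hd.2.1 1 (ι k i) (by simpa using ι_mem_Vgen i) a
  simpa [sub_eq_add_neg] using h

theorem map_ι_pow_mul (hd : IsDGDifferential k d) {i : Fin 3} (hi : d (ι k i) = 0) (m : ℕ)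
    {a : FreeAlgebra k (Fin 3)} (ha : d a = 0) : d (ι k i ^ m * a) = 0 := by
  induction m with
  | zero => simpa
  | succ m ih => rw [pow_succ', mul_assoc, hd.map_ι_mul, hi, ih]; simp

theorem map_normal (hd : IsDGDifferential k d) (hx2 : d (ι k 1) = 0) (hx3 : d (ι k 2) = 0)
    (i j : ℕ) : d (ι k 1 ^ i * ι k 2 ^ j) = 0 :=
  hd.map_ι_pow_mul hx2 i (by simpa using hd.map_ι_pow_mul hx3 j hd.map_one)

theorem normalSpan_le_ker (hd : IsDGDifferential k d) (hx2 : d (ι k 1) = 0)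
    (hx3 : d (ι k 2) = 0) (n : ℕ) : normalSpan k n ≤ LinearMap.ker d := by
  refine Submodule.span_le.mpr ?_
  rintro _ ⟨i, j, -, rfl⟩
  exact hd.map_normal hx2 hx3 i j

theorem skewRep_map (hd : IsDGDifferential k d)
    (hx1 : d (ι k 0) = ι k 1 * ι k 2 + ι k 2 * ι k 1) (hx2 : d (ι k 1) = 0)
    (hx3 : d (ι k 2) = 0) (a : FreeAlgebra k (Fin 3)) : skewRep k (d a) = 0 := by
  refine FreeAlgebra.mem_of_one_mem_of_ι_mul_mem
    (LinearMap.ker ((skewRep k).toLinearMap ∘ₗ d)) ?_ ?_ a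
  · simp [hd.map_one]
  · intro i a ha
    have ha' : skewRep k (d a) = 0 := ha
    have hgen : skewRep k (d (ι k i)) = 0 := by
      fin_cases i
      · simpa [hx1, skewRep] using skewY_mul_skewZ_add
      · simp [hx2]
      · simp [hx3]
    simp [hd.map_ι_mul, ha', hgen]

theorem eq_zero_of_mem_normalSpan_of_mem_range (hd : IsDGDifferential k d)
    (hx1 : d (ι k 0) = ι k 1 * ι k 2 + ι k 2 * ι k 1) (hx2 : d (ι k 1) = 0)
    (hx3 : d (ι k 2) = 0) {n : ℕ} {p : FreeAlgebra k (Fin 3)} (hp : p ∈ normalSpan k n)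
    (hr : p ∈ LinearMap.range d) : p = 0 := by
  obtain ⟨a, rfl⟩ := hr
  exact eq_zero_of_mem_normalSpan hp (hd.skewRep_map hx1 hx2 hx3 a)

theorem ι_mul_mem (hd : IsDGDifferential k d) {i : Fin 3} (hi : d (ι k i) = 0) {n : ℕ}
    {a : FreeAlgebra k (Fin 3)} (ha : a ∈ (prevPiece k n).map d) :
    ι k i * a ∈ (Vgen k ^ n).map d := by
  obtain ⟨c, hc, rfl⟩ := ha
  exact ⟨-(ι k i * c), neg_mem (ι_mul_mem_of_mem_prevPiece i hc), by
    simp [hd.map_ι_mul, hi]⟩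

theorem ι_two_mul_mem (hd : IsDGDifferential k d)
    (hx1 : d (ι k 0) = ι k 1 * ι k 2 + ι k 2 * ι k 1) (hx2 : d (ι k 1) = 0)
    (hx3 : d (ι k 2) = 0) {n : ℕ} {b : FreeAlgebra k (Fin 3)} (hb : b ∈ normalSpan k n) :
    ι k 2 * b ∈ normalSpan k (n + 1) ⊔ (Vgen k ^ n).map d := by
  suffices normalSpan k n ≤ (normalSpan k (n + 1) ⊔ (Vgen k ^ n).map d).comap
    (LinearMap.mulLeft k (ι k 2)) from this hb
  clear hb
  refine Submodule.span_le.mpr ?_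
  rintro _ ⟨i, j, rfl, rfl⟩
  change ι k 2 * (ι k (1 : Fin 3) ^ i * ι k 2 ^ j) ∈
    normalSpan k (i + j + 1) ⊔ (Vgen k ^ (i + j)).map d
  induction i with
  | zero =>
    refine Submodule.mem_sup_left (Submodule.subset_span ⟨0, j + 1, by omega, ?_⟩)
    simp [pow_succ']
  | succ i ih =>
    have hw : ι k 1 ^ i * ι k 2 ^ j ∈ Vgen k ^ (i + j) :=
      normalSpan_le_Vgen_pow _ (Submodule.subset_span ⟨i, j, rfl, rfl⟩)
    have hdw := hd.map_normal hx2 hx3 i j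
    rw [pow_succ', mul_assoc, add_right_comm i 1 j]
    generalize ι k (1 : Fin 3) ^ i * ι k 2 ^ j = w at hw hdw ih ⊢
    have hyz : ι k 1 * (ι k 2 * w) ∈
        normalSpan k (i + j + 1 + 1) ⊔ (Vgen k ^ (i + j + 1)).map d := by
      obtain ⟨b, hb, c, hc, hbc⟩ := Submodule.mem_sup.mp ih
      rw [← hbc, mul_add]
      exact Submodule.add_mem_sup (ι_one_mul_mem_normalSpan hb)
        (hd.ι_mul_mem (n := i + j + 1) hx2 hc)
    have hx : d (ι k 0 * w) ∈ normalSpan k (i + j + 1 + 1) ⊔ (Vgen k ^ (i + j + 1)).map d :=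
      Submodule.mem_sup_right ⟨_, ι_mul_mem_Vgen_pow 0 hw, rfl⟩
    convert sub_mem hx hyz using 1
    rw [hd.map_ι_mul, hx1, hdw]
    noncomm_ring

/-- Every cocycle of degree `n` is a normal form plus the coboundary of an element of
degree `n - 1`. -/
theorem mem_normalSpan_sup_map (hd : IsDGDifferential k d)
    (hx1 : d (ι k 0) = ι k 1 * ι k 2 + ι k 2 * ι k 1) (hx2 : d (ι k 1) = 0)
    (hx3 : d (ι k 2) = 0) (n : ℕ) {a : FreeAlgebra k (Fin 3)} (ha : a ∈ Vgen k ^ n)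
    (hda : d a = 0) : a ∈ normalSpan k n ⊔ (prevPiece k n).map d := by
  induction n generalizing a with
  | zero =>
    refine Submodule.mem_sup_left ?_
    rw [pow_zero, Submodule.one_eq_span] at ha
    refine Submodule.span_mono ?_ ha
    rintro _ rfl
    exact ⟨0, 0, rfl, by simp⟩
  | succ n ih =>
    obtain ⟨r, hr, p, hp, q, hq, rfl⟩ := exists_of_mem_Vgen_pow_succ ha
    have hcoeff : ι k 0 * (-d r) + ι k 1 * (ι k 2 * r - d p) + ι k 2 * (ι k 1 * r - d q) = 0 := by
      rw [← hda]
      simp only [map_add, hd.map_ι_mul, hx1, hx2, hx3]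
      noncomm_ring
    obtain ⟨hdr, hdp, hdq⟩ := eq_zero_of_ι_mul_add_eq_zero hcoeff
    rw [neg_eq_zero] at hdr
    rw [sub_eq_zero] at hdp hdq
    obtain ⟨b, hb, _, ⟨s, hs, rfl⟩, rfl⟩ := Submodule.mem_sup.mp (ih hr hdr)
    have hyb : ι k 1 * b = 0 := by
      refine hd.eq_zero_of_mem_normalSpan_of_mem_range hx1 hx2 hx3
        (ι_one_mul_mem_normalSpan hb) ⟨q + ι k 1 * s, ?_⟩
      rw [map_add, ← hdq, hd.map_ι_mul, hx2]
      noncomm_ring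
    obtain rfl : b = 0 := (eq_zero_of_ι_mul_add_eq_zero (r := 0) (q := 0) (by simpa using hyb)).2.1
    rw [zero_add] at hdp hdq
    have hP := ih (add_mem hp (ι_mul_mem_of_mem_prevPiece 2 hs))
      (by rw [map_add, ← hdp, hd.map_ι_mul, hx3]; simp)
    have hQ := ih (add_mem hq (ι_mul_mem_of_mem_prevPiece 1 hs))
      (by rw [map_add, ← hdq, hd.map_ι_mul, hx2]; simp)
    have hY : ι k 1 * (p + ι k 2 * s) ∈ normalSpan k (n + 1) ⊔ (Vgen k ^ n).map d := by
      obtain ⟨b, hb, c, hc, hbc⟩ := Submodule.mem_sup.mp hP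
      rw [← hbc, mul_add]
      exact Submodule.add_mem_sup (ι_one_mul_mem_normalSpan hb) (hd.ι_mul_mem hx2 hc)
    have hZ : ι k 2 * (q + ι k 1 * s) ∈ normalSpan k (n + 1) ⊔ (Vgen k ^ n).map d := by
      obtain ⟨b, hb, c, hc, hbc⟩ := Submodule.mem_sup.mp hQ
      rw [← hbc, mul_add]
      exact add_mem (hd.ι_two_mul_mem hx1 hx2 hx3 hb)
        (Submodule.mem_sup_right (hd.ι_mul_mem hx3 hc))
    have hX : d (ι k 0 * s) ∈ normalSpan k (n + 1) ⊔ (Vgen k ^ n).map d :=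
      Submodule.mem_sup_right ⟨_, ι_mul_mem_of_mem_prevPiece 0 hs, rfl⟩
    change _ ∈ normalSpan k (n + 1) ⊔ (Vgen k ^ n).map d
    convert sub_mem (add_mem hY hZ) hX using 1
    rw [hd.map_ι_mul, hx1]
    noncomm_ring

end IsDGDifferential

end

/-- Suppose `d` is a differential on `A` with `d x1 = x2*x3 + x3*x2`,
`d x2 = 0` and `d x3 = 0`. Then for every `n ≥ 0`:
`ker d ∩ A_n = (range d ∩ A_n) + span_k{x2^i * x3^j : i + j = n}` and
`span_k{x2^i * x3^j : i + j = n} ∩ range d = 0`.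
(Equivalently, `H(A, d) ≅ k⟨⌈x2⌉,⌈x3⌉⟩/(⌈x2⌉·⌈x3⌉ + ⌈x3⌉·⌈x2⌉)`.) -/
theorem cohomology_of_dgfree_skewPolynomial (k : Type*) [Field k] [CharZero k]
    (d : FreeAlgebra k (Fin 3) →ₗ[k] FreeAlgebra k (Fin 3))
    (hd : IsDGDifferential k d)
    (hx1 : d (FreeAlgebra.ι k 0) =
      FreeAlgebra.ι k 1 * FreeAlgebra.ι k 2 + FreeAlgebra.ι k 2 * FreeAlgebra.ι k 1)
    (hx2 : d (FreeAlgebra.ι k 1) = 0)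
    (hx3 : d (FreeAlgebra.ι k 2) = 0) :
    (∀ n : ℕ,
      LinearMap.ker d ⊓ (Vgen k) ^ n =
        (LinearMap.range d ⊓ (Vgen k) ^ n) ⊔
          Submodule.span k
            {p : FreeAlgebra k (Fin 3) |
              ∃ i j : ℕ, i + j = n ∧ p = FreeAlgebra.ι k 1 ^ i * FreeAlgebra.ι k 2 ^ j}) ∧
    (∀ n : ℕ,
      Submodule.span k
          {p : FreeAlgebra k (Fin 3) |
            ∃ i j : ℕ, i + j = n ∧ p = FreeAlgebra.ι k 1 ^ i * FreeAlgebra.ι k 2 ^ j} ⊓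
        LinearMap.range d = ⊥) := by
  refine ⟨fun n => le_antisymm ?_ (sup_le ?_ ?_), fun n => ?_⟩
  · rintro a ⟨hda, ha⟩
    obtain ⟨b, hb, _, ⟨c, -, rfl⟩, rfl⟩ :=
      Submodule.mem_sup.mp (hd.mem_normalSpan_sup_map hx1 hx2 hx3 n ha hda)
    rw [add_comm]
    refine Submodule.add_mem_sup ⟨⟨c, rfl⟩, ?_⟩ hb
    simpa using sub_mem ha (normalSpan_le_Vgen_pow n hb)
  · rintro _ ⟨⟨c, rfl⟩, hc⟩
    exact ⟨hd.2.2 c, hc⟩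
  · exact le_inf (hd.normalSpan_le_ker hx2 hx3 n) (normalSpan_le_Vgen_pow n)
  · rw [eq_bot_iff]
    rintro p ⟨hp, hr⟩
    exact hd.eq_zero_of_mem_normalSpan_of_mem_range hx1 hx2 hx3 hp hr
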